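/- For every τ ∈ (0,1) there is a constant C_τ such that for every N ≥ 1, every measure ν on the boundary of the bi-tree T² of depth N, and every ε > 0, one has E_ε[ν] ≤ C_τ·ε^{1−τ}·E[ν]^τ·|ν|^{1−τ}. -/

import Mathlib

open Finset

def strings : ℕ → Finset (List Bool)
  | 0 => {([] : List Bool)}
  | N + 1 =>
      {([] : List Bool)} ∪ (strings N).image (List.cons true) ∪ (strings N).image (List.cons false)

/-- Vertices of the bi-tree `T²` of depth `N`: pairs of binary strings of length at most `N`,
ordered by `(α,β) ≤ (α',β')` iff `α' <+: α` and `β' <+: β`. -/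
def biVertices (N : ℕ) : Finset (List Bool × List Bool) := strings N ×ˢ strings N

/-- `𝕀 f (p) = ∑_{p' ≥ p} f p'`. -/
noncomputable def biI (N : ℕ) (f : List Bool × List Bool → ℝ) (p : List Bool × List Bool) : ℝ :=
  ∑ q ∈ (biVertices N).filter (fun q => q.1 <+: p.1 ∧ q.2 <+: p.2), f q

/-- `𝕀* f (p) = ∑_{p' ≤ p} f p'`. -/
noncomputable def biIstar (N : ℕ) (f : List Bool × List Bool → ℝ) (p : List Bool × List Bool) : ℝ :=
  ∑ q ∈ (biVertices N).filter (fun q => p.1 <+: q.1 ∧ p.2 <+: q.2), f q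

/-- The potential `V^μ = 𝕀 (𝕀* μ)` on the bi-tree. -/
noncomputable def biV (N : ℕ) (μ : List Bool × List Bool → ℝ) : List Bool × List Bool → ℝ :=
  biI N (biIstar N μ)

/-- The total mass `|μ|`. -/
noncomputable def biMass (N : ℕ) (μ : List Bool × List Bool → ℝ) : ℝ :=
  ∑ p ∈ biVertices N, μ p

/-- A measure on the boundary `∂T²`: a nonnegative function vanishing off pairs of strings
both of length exactly `N`. -/
def IsBiMeasureOnBoundary (N : ℕ) (μ : List Bool × List Bool → ℝ) : Prop :=
  (∀ p, 0 ≤ μ p) ∧ ∀ p, μ p ≠ 0 → p.1.length = N ∧ p.2.length = N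

/-- The energy `E[ν] = ∑_{α∈T²} (𝕀*ν(α))²`. -/
noncomputable def biEnergy (N : ℕ) (ν : List Bool × List Bool → ℝ) : ℝ :=
  ∑ p ∈ biVertices N, (biIstar N ν p) ^ 2

/-- The partial energy `E_ε[ν] = ∑_{α∈T² : V^ν(α) ≤ ε} (𝕀*ν(α))²`. -/
noncomputable def biPartialEnergy (N : ℕ) (ν : List Bool × List Bool → ℝ) (ε : ℝ) : ℝ :=
  ∑ p ∈ (biVertices N).filter (fun p => biV N ν p ≤ ε), (biIstar N ν p) ^ 2

/-- `cap(E) = inf { ∑ f² : f ≥ 0, 𝕀f ≥ 1 on E }` on the bi-tree of depth `N`. -/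
noncomputable def biCap (N : ℕ) (E : Set (List Bool × List Bool)) : ℝ :=
  sInf { t : ℝ | ∃ f : List Bool × List Bool → ℝ, (∀ p, 0 ≤ f p) ∧
    (∀ p ∈ E, 1 ≤ biI N f p) ∧ t = ∑ p ∈ biVertices N, (f p) ^ 2 }

/-- Superadditivity in each variable on the bi-tree of depth `N`. -/
def BiSuperadditive (N : ℕ) (g : List Bool × List Bool → ℝ) : Prop :=
  (∀ α β : List Bool, α.length < N → β.length ≤ N →
    g (α ++ [false], β) + g (α ++ [true], β) ≤ g (α, β)) ∧
  (∀ α β : List Bool, α.length ≤ N → β.length < N →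
    g (α, β ++ [false]) + g (α, β ++ [true]) ≤ g (α, β))

section Chain

variable {X : Type*} [PartialOrder X]

/-- Induction on a finite chain by adjoining a new least element. -/
@[elab_as_elim]
theorem chain_induction {p : Finset X → Prop} (s : Finset X)
    (hs : IsChain (· ≤ ·) (s : Set X)) (empty : p ∅)
    (step : ∀ (m : X) (t : Finset X) (hm : m ∉ t), (∀ c ∈ t, m ≤ c) → p t → p (cons m t hm)) :
    p s := by
  classical
  induction s using Finset.strongInduction with
  | H s ih =>
    rcases s.eq_empty_or_nonempty with rfl | hne
    · exact empty
    · obtain ⟨m, hm, hmin⟩ := s.exists_minimal hne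
      have hle : ∀ c ∈ s, m ≤ c := by
        intro c hc
        rcases hs.total hm hc with h | h
        · exact h
        · exact hmin hc h
      have := step m (s.erase m) (notMem_erase m s)
        (fun c hc => hle c (mem_of_mem_erase hc))
        (ih _ (erase_ssubset hm) (hs.mono (by simp)))
      rwa [cons_eq_insert, insert_erase hm] at this

/-- The order of a rooted forest, with roots on top: the elements above a given one are
pairwise comparable. -/
def IsForest (X : Type*) [PartialOrder X] : Prop :=
  ∀ ⦃x a b : X⦄, x ≤ a → x ≤ b → a ≤ b ∨ b ≤ a

theorem IsForest.isChain (hX : IsForest X) {x : X} {s : Finset X} (hs : ∀ a ∈ s, x ≤ a) :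
    IsChain (· ≤ ·) (s : Set X) :=
  fun _ ha _ hb _ => hX (hs _ ha) (hs _ hb)

variable [DecidableLE X]

theorem sum_cons_filter_le {m : X} {t : Finset X} (hm : m ∉ t) (hle : ∀ c ∈ t, m ≤ c)
    (φ : X → Finset X → ℝ) :
    ∑ c ∈ cons m t hm, φ c ((cons m t hm).filter (c ≤ ·)) =
      φ m (cons m t hm) + ∑ c ∈ t, φ c (t.filter (c ≤ ·)) := by
  rw [sum_cons]
  congr 1
  · rw [filter_true_of_mem fun c hc => ?_]
    rcases mem_cons.1 hc with rfl | h
    exacts [le_rfl, hle c h]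
  · refine sum_congr rfl fun c hc => ?_
    rw [filter_cons_of_neg]
    exact fun h => hm (le_antisymm h (hle c hc) ▸ hc)

theorem exp_sub_one_le_mul_exp (k : ℝ) : Real.exp k - 1 ≤ k * Real.exp k := by
  have h := Real.add_one_le_exp (-k)
  have h2 : Real.exp (-k) * Real.exp k = 1 := by rw [← Real.exp_add]; simp
  nlinarith [Real.exp_pos k]

theorem exp_sum_le_of_isChain {s : Finset X} (hs : IsChain (· ≤ ·) (s : Set X)) (k : X → ℝ) :
    Real.exp (∑ c ∈ s, k c) ≤
      1 + ∑ c ∈ s, k c * Real.exp (∑ d ∈ s with c ≤ d, k d) := by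
  refine chain_induction s hs ?_ ?_
  · simp
  intro m t hm hle ih
  rw [sum_cons_filter_le hm hle fun c u => k c * Real.exp (∑ d ∈ u, k d), sum_cons]
  have h := exp_sub_one_le_mul_exp (k m)
  rw [Real.exp_add]
  nlinarith [Real.exp_pos (∑ c ∈ t, k c)]

theorem sum_mul_exp_sum_le_of_isChain {s : Finset X} (hs : IsChain (· ≤ ·) (s : Set X))
    {h k : X → ℝ} (hh : ∀ c, 0 ≤ h c) (hk : ∀ c, 0 ≤ k c) :
    (∑ c ∈ s, h c) * Real.exp (∑ c ∈ s, k c) ≤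
      ∑ c ∈ s, (h c + (∑ d ∈ s with c ≤ d, h d) * k c) *
        Real.exp (∑ d ∈ s with c ≤ d, k d) := by
  refine chain_induction s hs ?_ ?_
  · simp
  intro m t hm hle ih
  rw [sum_cons_filter_le hm hle fun c u =>
    (h c + (∑ d ∈ u, h d) * k c) * Real.exp (∑ d ∈ u, k d), sum_cons, sum_cons]
  have h1 := exp_sub_one_le_mul_exp (k m)
  have hS : 0 ≤ ∑ c ∈ t, h c := sum_nonneg fun c _ => hh c
  have h2 : (∑ c ∈ t, h c) * Real.exp (∑ c ∈ t, k c) * (Real.exp (k m) - 1) ≤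
      (∑ c ∈ t, h c) * Real.exp (∑ c ∈ t, k c) * (k m * Real.exp (k m)) := by
    gcongr
  have h3 : 0 ≤ h m * k m * (Real.exp (k m) * Real.exp (∑ c ∈ t, k c)) := by
    have := hh m; have := hk m; positivity
  rw [Real.exp_add]
  nlinarith

theorem sq_sum_le_of_isChain {s : Finset X} (hs : IsChain (· ≤ ·) (s : Set X))
    {h : X → ℝ} :
    (∑ c ∈ s, h c) ^ 2 ≤ 2 * ∑ c ∈ s, h c * ∑ d ∈ s with c ≤ d, h d := by
  refine chain_induction s hs ?_ ?_
  · simp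
  intro m t hm hle ih
  rw [sum_cons_filter_le hm hle fun c u => h c * ∑ d ∈ u, h d, sum_cons]
  nlinarith [sq_nonneg (h m)]

theorem sum_filter_le_of_isChain {s : Finset X} (hs : IsChain (· ≤ ·) (s : Set X))
    {h : X → ℝ} {p : X → Prop} [DecidablePred p] {K : ℝ} (hK : 0 ≤ K) (hh : ∀ c, 0 ≤ h c)
    (hp : ∀ c ∈ s, p c → ∑ d ∈ s with c ≤ d, h d ≤ K) :
    ∑ c ∈ s with p c, h c ≤ K := by
  rcases (s.filter p).eq_empty_or_nonempty with he | hne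
  · rwa [he, sum_empty]
  · obtain ⟨m, hm, hmin⟩ := (s.filter p).exists_minimal hne
    rw [mem_filter] at hm
    refine (sum_le_sum_of_subset_of_nonneg ?_ fun c _ _ => hh c).trans (hp m hm.1 hm.2)
    intro c hc
    have hc' := mem_filter.1 hc
    refine mem_filter.2 ⟨hc'.1, ?_⟩
    rcases hs.total hm.1 hc'.1 with h | h
    · exact h
    · exact hmin hc h

variable [Fintype X]

theorem sum_sum_le_comm (k : X → X → ℝ) :
    ∑ x, ∑ a with x ≤ a, k x a = ∑ a, ∑ x with x ≤ a, k x a :=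
  sum_comm' (by simp)

theorem sum_sum_sum_interval_comm (k : X → X → X → ℝ) :
    ∑ x, ∑ A with x ≤ A, ∑ a with x ≤ a ∧ a ≤ A, k x A a =
      ∑ a, ∑ A with a ≤ A, ∑ x with x ≤ a, k x A a := by
  have h1 : ∀ x, ∑ A with x ≤ A, ∑ a with x ≤ a ∧ a ≤ A, k x A a =
      ∑ a with x ≤ a, ∑ A with a ≤ A, k x A a := by
    intro x
    refine sum_comm' fun A a => ?_
    simp only [mem_filter, mem_univ, true_and]
    exact ⟨fun h => ⟨h.2.2, h.2.1⟩, fun h => ⟨h.2.trans h.1, h.2, h.1⟩⟩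
  rw [sum_congr rfl fun x _ => h1 x, sum_sum_le_comm]
  exact sum_congr rfl fun a _ => sum_comm

theorem IsForest.isChain_filter (hX : IsForest X) (x : X) :
    IsChain (· ≤ ·) ((univ.filter (x ≤ ·) : Finset X) : Set X) :=
  hX.isChain (x := x) (by simp)

/-- The one-dimensional maximum principle. -/
theorem IsForest.sum_truncated_mul_le (hX : IsForest X) {μ h : X → ℝ} {p : X → Prop}
    [DecidablePred p] {K : ℝ} (hK : 0 ≤ K) (hμ : ∀ x, 0 ≤ μ x) (hh : ∀ x, 0 ≤ h x)
    (hup : ∀ x a, x ≤ a → p x → p a) (hp : ∀ x, p x → ∑ a with x ≤ a, h a ≤ K) (B : X) :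
    ∑ b with b ≤ B, (if p b then ∑ x with x ≤ b, μ x else 0) * h b ≤
      K * (if p B then ∑ x with x ≤ B, μ x else 0) := by
  by_cases hB : p B
  · rw [if_pos hB, mul_sum]
    have h1 : ∀ b, (if p b then ∑ x with x ≤ b, μ x else 0) * h b =
        ∑ x with x ≤ b, μ x * (if p b then h b else 0) := by
      intro b
      split_ifs <;> simp [sum_mul]
    rw [sum_congr rfl fun b _ => h1 b]
    have h2 : ∑ b with b ≤ B, ∑ x with x ≤ b, μ x * (if p b then h b else 0) =
        ∑ x with x ≤ B, ∑ b with x ≤ b ∧ b ≤ B, μ x * (if p b then h b else 0) := by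
      refine sum_comm' fun b x => ?_
      simp only [mem_filter, mem_univ, true_and]
      exact ⟨fun h => ⟨⟨h.2, h.1⟩, h.2.trans h.1⟩, fun h => ⟨h.1.2, h.1.1⟩⟩
    rw [h2]
    refine sum_le_sum fun x _ => ?_
    rw [← mul_sum, mul_comm K, ← sum_filter]
    refine mul_le_mul_of_nonneg_left ?_ (hμ x)
    refine sum_filter_le_of_isChain (hX.isChain (x := x) (by simp +contextual)) hK hh ?_
    intro c _ hc
    refine (sum_le_sum_of_subset_of_nonneg ?_ fun c _ _ => hh c).trans (hp c hc)
    intro d hd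
    simp only [mem_filter, mem_univ, true_and] at hd ⊢
    exact hd.2
  · rw [if_neg hB, mul_zero]
    refine (sum_eq_zero fun b hb => ?_).le
    rw [if_neg fun h => hB (hup b B (by simpa using hb) h), zero_mul]

end Chain

section OneSided

variable {X Y : Type*}

/-- Summation over the ancestors of the first coordinate. -/
def sumUpLeft [Fintype X] [PartialOrder X] [DecidableLE X] (F : X → Y → ℝ) (a : X) (b : Y) : ℝ :=
  ∑ a' with a ≤ a', F a' b

/-- Summation over the ancestors of the second coordinate. -/
def sumUpRight [Fintype Y] [PartialOrder Y] [DecidableLE Y] (F : X → Y → ℝ) (a : X) (b : Y) : ℝ :=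
  ∑ b' with b ≤ b', F a b'

theorem sumUpLeft_nonneg [Fintype X] [PartialOrder X] [DecidableLE X] {F : X → Y → ℝ}
    (hF : ∀ a b, 0 ≤ F a b) (a : X) (b : Y) : 0 ≤ sumUpLeft F a b :=
  sum_nonneg fun _ _ => hF _ _

theorem sumUpRight_nonneg [Fintype Y] [PartialOrder Y] [DecidableLE Y] {F : X → Y → ℝ}
    (hF : ∀ a b, 0 ≤ F a b) (a : X) (b : Y) : 0 ≤ sumUpRight F a b :=
  sum_nonneg fun _ _ => hF _ _

theorem sumUpLeft_const_mul [Fintype X] [PartialOrder X] [DecidableLE X] (c : ℝ)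
    (F : X → Y → ℝ) (a : X) (b : Y) :
    sumUpLeft (fun a b => c * F a b) a b = c * sumUpLeft F a b := by
  simp only [sumUpLeft, mul_sum]

theorem sumUpRight_const_mul [Fintype Y] [PartialOrder Y] [DecidableLE Y] (c : ℝ)
    (F : X → Y → ℝ) (a : X) (b : Y) :
    sumUpRight (fun a b => c * F a b) a b = c * sumUpRight F a b := by
  simp only [sumUpRight, mul_sum]

theorem sum_sum_mul_le_sqrt [Fintype X] [Fintype Y] (f g : X → Y → ℝ) :
    ∑ a, ∑ b, f a b * g a b ≤ √(∑ a, ∑ b, f a b ^ 2) * √(∑ a, ∑ b, g a b ^ 2) := by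
  simp only [← Fintype.sum_prod_type']
  exact Real.sum_mul_le_sqrt_mul_sqrt univ (fun p : X × Y => f p.1 p.2) fun p => g p.1 p.2

end OneSided

section BiForest

variable {X Y : Type*} [Fintype X] [PartialOrder X] [DecidableLE X]
  [Fintype Y] [PartialOrder Y] [DecidableLE Y]

/-- Summation over the ancestors in the product order. -/
def sumUp (F : X → Y → ℝ) (a : X) (b : Y) : ℝ := ∑ a' with a ≤ a', ∑ b' with b ≤ b', F a' b'

/-- Summation over the descendants in the product order. -/
def sumDown (ν : X → Y → ℝ) (a : X) (b : Y) : ℝ := ∑ x with x ≤ a, ∑ y with y ≤ b, ν x y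

theorem sumDown_nonneg {F : X → Y → ℝ} (hF : ∀ a b, 0 ≤ F a b) (a : X) (b : Y) :
    0 ≤ sumDown F a b := sum_nonneg fun _ _ => sum_nonneg fun _ _ => hF _ _

theorem sumUp_eq_sum_sumUpRight (F : X → Y → ℝ) (a : X) (b : Y) :
    sumUp F a b = ∑ a' with a ≤ a', sumUpRight F a' b := rfl

theorem sumUp_eq_sum_sumUpLeft (F : X → Y → ℝ) (a : X) (b : Y) :
    sumUp F a b = ∑ b' with b ≤ b', sumUpLeft F a b' := sum_comm

theorem sumUp_mono {F G : X → Y → ℝ} (h : ∀ a b, F a b ≤ G a b) (a : X) (b : Y) :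
    sumUp F a b ≤ sumUp G a b := sum_le_sum fun _ _ => sum_le_sum fun _ _ => h _ _

theorem sumUp_anti {F : X → Y → ℝ} (hF : ∀ a b, 0 ≤ F a b) {a a' : X} {b b' : Y}
    (ha : a ≤ a') (hb : b ≤ b') : sumUp F a' b' ≤ sumUp F a b := by
  refine (sum_le_sum_of_subset_of_nonneg (monotone_filter_right _ fun _ _ h => ha.trans h)
    fun _ _ _ => sum_nonneg fun _ _ => hF _ _).trans (sum_le_sum fun x _ => ?_)
  exact sum_le_sum_of_subset_of_nonneg (monotone_filter_right _ fun _ _ h => hb.trans h)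
    fun _ _ _ => hF _ _

theorem sum_mul_sumUp (ν F : X → Y → ℝ) :
    ∑ x, ∑ y, ν x y * sumUp F x y = ∑ a, ∑ b, sumDown ν a b * F a b := by
  simp only [sumUp, sumDown, mul_sum, sum_mul]
  calc ∑ x, ∑ y, ∑ a with x ≤ a, ∑ b with y ≤ b, ν x y * F a b
      = ∑ x, ∑ a with x ≤ a, ∑ y, ∑ b with y ≤ b, ν x y * F a b :=
        sum_congr rfl fun x _ => sum_comm
    _ = ∑ a, ∑ x with x ≤ a, ∑ b, ∑ y with y ≤ b, ν x y * F a b := by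
        rw [sum_sum_le_comm]
        exact sum_congr rfl fun a _ => sum_congr rfl fun x _ => sum_sum_le_comm _
    _ = ∑ a, ∑ b, ∑ x with x ≤ a, ∑ y with y ≤ b, ν x y * F a b :=
        sum_congr rfl fun a _ => sum_comm

/-- The mixed second difference of `exp (κ * sumUp F)` is at most this kernel. -/
noncomputable def expKernel (κ : ℝ) (F : X → Y → ℝ) (a : X) (b : Y) : ℝ :=
  (κ * F a b + κ ^ 2 * (sumUpLeft F a b * sumUpRight F a b)) * Real.exp (κ * sumUp F a b)

theorem expKernel_nonneg {κ : ℝ} (hκ : 0 ≤ κ) {F : X → Y → ℝ} (hF : ∀ a b, 0 ≤ F a b)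
    (a : X) (b : Y) : 0 ≤ expKernel κ F a b := by
  have h1 := hF a b
  have h2 := sumUpLeft_nonneg hF a b
  have h3 := sumUpRight_nonneg hF a b
  unfold expKernel
  positivity

theorem exp_sum_sum_le {κ : ℝ} (hκ : 0 ≤ κ) {F : X → Y → ℝ} (hF : ∀ a b, 0 ≤ F a b)
    {s : Finset X} {t : Finset Y} (hs : IsChain (· ≤ ·) (s : Set X))
    (ht : IsChain (· ≤ ·) (t : Set Y)) :
    Real.exp (κ * ∑ a ∈ s, ∑ b ∈ t, F a b) ≤ 1 + ∑ a ∈ s, ∑ b ∈ t, expKernel κ F a b := by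
  have h1 := exp_sum_le_of_isChain hs fun a => ∑ b ∈ t, κ * F a b
  simp only [mul_sum]
  refine h1.trans (add_le_add_right (sum_le_sum fun a _ => ?_) 1)
  have hκF : ∀ a b, 0 ≤ κ * F a b := fun a b => mul_nonneg hκ (hF a b)
  rw [sum_comm]
  refine (sum_mul_exp_sum_le_of_isChain ht (fun b => hκF a b)
    (fun b => sum_nonneg fun a' _ => hκF a' b)).trans (sum_le_sum fun b _ => ?_)
  have hr : ∑ b' ∈ t with b ≤ b', κ * F a b' ≤ κ * sumUpRight F a b := by
    rw [← mul_sum]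
    exact mul_le_mul_of_nonneg_left (sum_le_sum_of_subset_of_nonneg
      (filter_subset_filter _ (subset_univ _)) fun _ _ _ => hF _ _) hκ
  have hl : ∑ a' ∈ s with a ≤ a', κ * F a' b ≤ κ * sumUpLeft F a b := by
    rw [← mul_sum]
    exact mul_le_mul_of_nonneg_left (sum_le_sum_of_subset_of_nonneg
      (filter_subset_filter _ (subset_univ _)) fun _ _ _ => hF _ _) hκ
  have hu : ∑ b' ∈ t with b ≤ b', ∑ a' ∈ s with a ≤ a', κ * F a' b' ≤ κ * sumUp F a b := by
    simp only [← mul_sum]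
    refine mul_le_mul_of_nonneg_left ?_ hκ
    rw [sumUp_eq_sum_sumUpLeft]
    refine (sum_le_sum_of_subset_of_nonneg (filter_subset_filter _ (subset_univ _))
      fun _ _ _ => sum_nonneg fun _ _ => hF _ _).trans (sum_le_sum fun _ _ => ?_)
    exact sum_le_sum_of_subset_of_nonneg
      (filter_subset_filter _ (subset_univ _)) fun _ _ _ => hF _ _
  have hl0 : 0 ≤ ∑ a' ∈ s with a ≤ a', κ * F a' b := sum_nonneg fun _ _ => hκF _ _
  have hmul := mul_le_mul hr hl hl0 (mul_nonneg hκ (sumUpRight_nonneg hF a b))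
  unfold expKernel
  refine mul_le_mul (by linarith) (Real.exp_le_exp.2 hu) (Real.exp_pos _).le ?_
  have h1 := hF a b
  have h2 := sumUpLeft_nonneg hF a b
  have h3 := sumUpRight_nonneg hF a b
  positivity

theorem sumUp_le_add_sum_interval (hX : IsForest X) (hY : IsForest Y) {F : X → Y → ℝ}
    (hF : ∀ a b, 0 ≤ F a b) {x A : X} {y B : Y} (hA : x ≤ A) (hB : y ≤ B) :
    sumUp F x y ≤ sumUp F A y + sumUp F x B +
      ∑ a with x ≤ a ∧ a ≤ A, ∑ b with y ≤ b ∧ b ≤ B, F a b := by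
  simp only [sumUp, sum_filter]
  rw [← sum_add_distrib, ← sum_add_distrib]
  refine sum_le_sum fun a _ => ?_
  have key : ∀ b, (if y ≤ b then F a b else 0) ≤
      (if A ≤ a then if y ≤ b then F a b else 0 else 0) + (if B ≤ b then F a b else 0) +
      (if a ≤ A then if y ≤ b ∧ b ≤ B then F a b else 0 else 0) ∨ ¬ x ≤ a := by
    intro b
    by_cases hxa : x ≤ a
    · left
      have := hF a b
      by_cases hyb : y ≤ b
      · rcases hX hA hxa with h1 | h1
        · rw [if_pos hyb, if_pos h1]; split_ifs <;> simp [this]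
        · rcases hY hB hyb with h2 | h2
          · rw [if_pos hyb, if_pos h2]; split_ifs <;> simp [this]
          · rw [if_pos hyb, if_pos h1, if_pos (show y ≤ b ∧ b ≤ B from ⟨hyb, h2⟩)]
            split_ifs <;> linarith
      · have h3 : ¬ B ≤ b := fun h => hyb (hB.trans h)
        simp [hyb, h3]
    · exact Or.inr hxa
  by_cases hxa : x ≤ a
  · simp only [hxa, if_true, true_and]
    refine (sum_le_sum fun b _ => (key b).resolve_right (not_not.2 hxa)).trans ?_
    rw [sum_add_distrib, sum_add_distrib]
    split_ifs <;> simp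
  · have h3 : ¬ A ≤ a := fun h => hxa (hA.trans h)
    simp [hxa, h3]

end BiForest

section Energy

variable {X Y : Type*} [Fintype X] [PartialOrder X] [DecidableLE X]
  [Fintype Y] [PartialOrder Y] [DecidableLE Y]

theorem sum_sum_sum_sum_mul_comm (P Q : X → Y → ℝ) :
    ∑ x, ∑ y, ∑ A with x ≤ A, ∑ B with y ≤ B, P A y * Q x B =
      ∑ A, ∑ B, (∑ y with y ≤ B, P A y) * ∑ x with x ≤ A, Q x B := by
  calc ∑ x, ∑ y, ∑ A with x ≤ A, ∑ B with y ≤ B, P A y * Q x B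
      = ∑ x, ∑ A with x ≤ A, ∑ B, ∑ y with y ≤ B, P A y * Q x B :=
        sum_congr rfl fun x _ => by
          rw [sum_comm]; exact sum_congr rfl fun A _ => sum_sum_le_comm _
    _ = ∑ A, ∑ B, ∑ x with x ≤ A, ∑ y with y ≤ B, P A y * Q x B := by
        rw [sum_sum_le_comm]; exact sum_congr rfl fun A _ => sum_comm
    _ = _ := sum_congr rfl fun A _ => sum_congr rfl fun B _ => by
        rw [sum_mul_sum, sum_comm]

theorem sum_interval_mul_comm (P Q G : X → Y → ℝ) :
    ∑ x, ∑ y, ∑ A with x ≤ A, ∑ B with y ≤ B, P A y * Q x B *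
        ∑ a with x ≤ a ∧ a ≤ A, ∑ b with y ≤ b ∧ b ≤ B, G a b =
      ∑ a, ∑ b, G a b * ((∑ A with a ≤ A, ∑ y with y ≤ b, P A y) *
        ∑ B with b ≤ B, ∑ x with x ≤ a, Q x B) := by
  calc ∑ x, ∑ y, ∑ A with x ≤ A, ∑ B with y ≤ B, P A y * Q x B *
        ∑ a with x ≤ a ∧ a ≤ A, ∑ b with y ≤ b ∧ b ≤ B, G a b
      = ∑ x, ∑ y, ∑ A with x ≤ A, ∑ B with y ≤ B,
          ∑ a with x ≤ a ∧ a ≤ A, ∑ b with y ≤ b ∧ b ≤ B, P A y * Q x B * G a b := by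
        simp only [mul_sum]
    _ = ∑ x, ∑ A with x ≤ A, ∑ a with x ≤ a ∧ a ≤ A,
          ∑ y, ∑ B with y ≤ B, ∑ b with y ≤ b ∧ b ≤ B, P A y * Q x B * G a b :=
        sum_congr rfl fun x _ => by
          rw [sum_comm]
          refine sum_congr rfl fun A _ => ?_
          rw [sum_comm (s := filter _ _)]
          exact sum_congr rfl fun y _ => sum_comm
    _ = ∑ a, ∑ A with a ≤ A, ∑ x with x ≤ a,
          ∑ b, ∑ B with b ≤ B, ∑ y with y ≤ b, P A y * Q x B * G a b := by
        rw [sum_sum_sum_interval_comm]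
        exact sum_congr rfl fun a _ => sum_congr rfl fun A _ => sum_congr rfl fun x _ =>
          sum_sum_sum_interval_comm _
    _ = ∑ a, ∑ b, ∑ A with a ≤ A, ∑ B with b ≤ B, ∑ x with x ≤ a,
          ∑ y with y ≤ b, P A y * Q x B * G a b := by
        refine sum_congr rfl fun a _ => ?_
        rw [sum_comm (s := univ)]
        refine sum_congr rfl fun A _ => ?_
        rw [sum_comm]
        exact sum_congr rfl fun b _ => sum_comm
    _ = _ := by
        refine sum_congr rfl fun a _ => sum_congr rfl fun b _ => ?_
        rw [sum_mul_sum, mul_sum]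
        refine sum_congr rfl fun A _ => ?_
        rw [mul_sum]
        refine sum_congr rfl fun B _ => ?_
        rw [mul_comm (∑ y with y ≤ b, P A y), sum_mul_sum, mul_sum]
        refine sum_congr rfl fun x _ => ?_
        rw [mul_sum]
        exact sum_congr rfl fun y _ => by ring

/-- The exponentially weighted `L²` bound for the product of the one-sided sums. -/
theorem sum_exp_mul_sq_le (hX : IsForest X) (hY : IsForest Y) {F : X → Y → ℝ}
    (hF : ∀ a b, 0 ≤ F a b) (hu : ∀ a b, F a b ≠ 0 → sumUp F a b ≤ 1 / 8)
    (hl : ∀ A B, ∑ y with y ≤ B, F A y * sumUpLeft F A y ≤ 1 / 8 * F A B)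
    (hr : ∀ A B, ∑ x with x ≤ A, F x B * sumUpRight F x B ≤ 1 / 8 * F A B) :
    ∑ a, ∑ b, (sumUpLeft F a b * sumUpRight F a b) ^ 2 * Real.exp (sumUp F a b) ≤
      ∑ a, ∑ b, F a b ^ 2 := by
  set P : X → Y → ℝ := fun a b => F a b * sumUpLeft F a b with hP
  set Q : X → Y → ℝ := fun a b => F a b * sumUpRight F a b with hQ
  set G := expKernel 1 F with hG
  set S := ∑ a, ∑ b, F a b ^ 2 with hS
  set T := ∑ a, ∑ b, (sumUpLeft F a b * sumUpRight F a b) ^ 2 * Real.exp (sumUp F a b) with hT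
  have hl0 := sumUpLeft_nonneg hF
  have hr0 := sumUpRight_nonneg hF
  have hP0 : ∀ a b, 0 ≤ P a b := fun a b => mul_nonneg (hF a b) (hl0 a b)
  have hQ0 : ∀ a b, 0 ≤ Q a b := fun a b => mul_nonneg (hF a b) (hr0 a b)
  have hG0 : ∀ a b, 0 ≤ G a b := expKernel_nonneg zero_le_one hF
  have he8 : Real.exp (1 / 8) ≤ 8 / 7 := by
    have h := Real.add_one_le_exp (-(1 / 8 : ℝ))
    have h2 : Real.exp (-(1 / 8)) * Real.exp (1 / 8) = 1 := by rw [← Real.exp_add]; simp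
    nlinarith [Real.exp_pos (1 / 8)]
  have he4 : Real.exp (1 / 8 + 1 / 8) ≤ 4 / 3 := by
    rw [Real.exp_add]
    nlinarith [Real.exp_pos (1 / 8)]
  have hpt : ∀ x y, (sumUpLeft F x y * sumUpRight F x y) ^ 2 * Real.exp (sumUp F x y) ≤
      16 / 3 * ∑ A with x ≤ A, ∑ B with y ≤ B, P A y * Q x B *
        (1 + ∑ a with x ≤ a ∧ a ≤ A, ∑ b with y ≤ b ∧ b ≤ B, G a b) := by
    intro x y
    have h1 : sumUpLeft F x y ^ 2 ≤ 2 * ∑ A with x ≤ A, P A y := by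
      refine (sq_sum_le_of_isChain (hX.isChain_filter x)).trans ?_
      refine mul_le_mul_of_nonneg_left (sum_le_sum fun A _ => ?_) zero_le_two
      exact mul_le_mul_of_nonneg_left (sum_le_sum_of_subset_of_nonneg
        (filter_subset_filter _ (subset_univ _)) fun _ _ _ => hF _ _) (hF _ _)
    have h2 : sumUpRight F x y ^ 2 ≤ 2 * ∑ B with y ≤ B, Q x B := by
      refine (sq_sum_le_of_isChain (hY.isChain_filter y)).trans ?_
      refine mul_le_mul_of_nonneg_left (sum_le_sum fun A _ => ?_) zero_le_two
      exact mul_le_mul_of_nonneg_left (sum_le_sum_of_subset_of_nonneg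
        (filter_subset_filter _ (subset_univ _)) fun _ _ _ => hF _ _) (hF _ _)
    have h3 := mul_le_mul h1 h2 (sq_nonneg _) ((sq_nonneg _).trans h1)
    have h4 := mul_le_mul_of_nonneg_right h3 (Real.exp_pos (sumUp F x y)).le
    rw [← mul_pow] at h4
    refine h4.trans ?_
    have h5 : 2 * (∑ A with x ≤ A, P A y) * (2 * ∑ B with y ≤ B, Q x B) *
        Real.exp (sumUp F x y) =
        ∑ A with x ≤ A, ∑ B with y ≤ B, 4 * (P A y * Q x B * Real.exp (sumUp F x y)) := by
      simp only [← mul_sum, ← sum_mul]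
      ring
    rw [h5, mul_sum]
    refine sum_le_sum fun A hA => ?_
    rw [mul_sum]
    refine sum_le_sum fun B hB => ?_
    replace hA : x ≤ A := by simpa using hA
    replace hB : y ≤ B := by simpa using hB
    by_cases h0 : F A y = 0
    · simp [hP, h0]
    by_cases h0' : F x B = 0
    · simp [hQ, h0']
    have h6 := sumUp_le_add_sum_interval hX hY hF hA hB
    have h7 := exp_sum_sum_le zero_le_one hF
      (hX.isChain (x := x) (s := univ.filter fun a => x ≤ a ∧ a ≤ A) (by simp +contextual))
      (hY.isChain (x := y) (s := univ.filter fun b => y ≤ b ∧ b ≤ B) (by simp +contextual))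
    rw [one_mul] at h7
    have h8 : Real.exp (sumUp F x y) ≤ 4 / 3 *
        (1 + ∑ a with x ≤ a ∧ a ≤ A, ∑ b with y ≤ b ∧ b ≤ B, G a b) := by
      refine (Real.exp_le_exp.2 (h6.trans (add_le_add_left
        (add_le_add (hu _ _ h0) (hu _ _ h0')) _))).trans ?_
      rw [Real.exp_add]
      exact mul_le_mul he4 h7 (Real.exp_pos _).le (by norm_num)
    have h9 := mul_le_mul_of_nonneg_left h8 (mul_nonneg (hP0 A y) (hQ0 x B))
    linarith
  have hsum : T ≤ 16 / 3 * ∑ x, ∑ y, ∑ A with x ≤ A, ∑ B with y ≤ B, P A y * Q x B *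
        (1 + ∑ a with x ≤ a ∧ a ≤ A, ∑ b with y ≤ b ∧ b ≤ B, G a b) := by
    rw [mul_sum]
    refine sum_le_sum fun x _ => ?_
    rw [mul_sum]
    exact sum_le_sum fun y _ => hpt x y
  simp only [mul_add, mul_one, sum_add_distrib] at hsum
  rw [sum_sum_sum_sum_mul_comm, sum_interval_mul_comm] at hsum
  have hI : ∑ A, ∑ B, (∑ y with y ≤ B, P A y) * ∑ x with x ≤ A, Q x B ≤ 1 / 64 * S := by
    rw [hS, mul_sum]
    refine sum_le_sum fun A _ => ?_
    rw [mul_sum]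
    refine sum_le_sum fun B _ => ?_
    have := mul_le_mul (hl A B) (hr A B) (sum_nonneg fun _ _ => hQ0 _ _)
      (mul_nonneg (by norm_num) (hF A B))
    linarith
  have hII : ∑ a, ∑ b, G a b * ((∑ A with a ≤ A, ∑ y with y ≤ b, P A y) *
        ∑ B with b ≤ B, ∑ x with x ≤ a, Q x B) ≤ 1 / 64 * (4 / 7 * S + 3 / 2 * T) := by
    rw [hS, hT]
    simp only [mul_sum, ← sum_add_distrib]
    refine sum_le_sum fun a _ => sum_le_sum fun b _ => ?_
    have hl1 : ∑ A with a ≤ A, ∑ y with y ≤ b, P A y ≤ 1 / 8 * sumUpLeft F a b := by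
      rw [sumUpLeft, mul_sum]
      exact sum_le_sum fun A _ => hl A b
    have hr1 : ∑ B with b ≤ B, ∑ x with x ≤ a, Q x B ≤ 1 / 8 * sumUpRight F a b := by
      rw [sumUpRight, mul_sum]
      exact sum_le_sum fun B _ => hr a B
    have h1 := mul_le_mul hl1 hr1 (sum_nonneg fun _ _ => sum_nonneg fun _ _ => hQ0 _ _)
      (mul_nonneg (by norm_num) (hl0 a b))
    have h2 := mul_le_mul_of_nonneg_left h1 (hG0 a b)
    simp only [mul_sum] at h2
    refine h2.trans ?_
    have h3 : F a b ^ 2 * Real.exp (sumUp F a b) ≤ F a b ^ 2 * (8 / 7) := by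
      by_cases h0 : F a b = 0
      · simp [h0]
      · exact mul_le_mul_of_nonneg_left ((Real.exp_le_exp.2 (hu a b h0)).trans he8)
          (sq_nonneg _)
    have h4 := mul_nonneg (sq_nonneg (F a b - sumUpLeft F a b * sumUpRight F a b))
      (Real.exp_pos (sumUp F a b)).le
    simp only [hG, expKernel, one_mul, one_pow]
    nlinarith
  have hS0 : 0 ≤ S := sum_nonneg fun _ _ => sum_nonneg fun _ _ => sq_nonneg _
  linarith

end Energy

section PartialEnergy

variable {X Y : Type*} [Fintype X] [PartialOrder X] [DecidableLE X]
  [Fintype Y] [PartialOrder Y] [DecidableLE Y]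

/-- The function `sumDown ν` truncated to the set where the potential of `ν` is at most `ε`. -/
noncomputable def truncatedDown (ν : X → Y → ℝ) (ε : ℝ) (a : X) (b : Y) : ℝ :=
  if sumUp (sumDown ν) a b ≤ ε then sumDown ν a b else 0

theorem truncatedDown_nonneg {ν : X → Y → ℝ} (hν : ∀ x y, 0 ≤ ν x y) (ε : ℝ) (a : X) (b : Y) :
    0 ≤ truncatedDown ν ε a b := by
  unfold truncatedDown
  split_ifs
  exacts [sumDown_nonneg hν a b, le_rfl]

theorem truncatedDown_le {ν : X → Y → ℝ} (hν : ∀ x y, 0 ≤ ν x y) (ε : ℝ) (a : X) (b : Y) :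
    truncatedDown ν ε a b ≤ sumDown ν a b := by
  unfold truncatedDown
  split_ifs
  exacts [le_rfl, sumDown_nonneg hν a b]

theorem sumUp_truncatedDown_le {ν : X → Y → ℝ} (hν : ∀ x y, 0 ≤ ν x y) {ε : ℝ} {a : X} {b : Y}
    (h : sumUp (sumDown ν) a b ≤ ε) : sumUp (truncatedDown ν ε) a b ≤ ε :=
  (sumUp_mono (truncatedDown_le hν ε) a b).trans h

theorem sum_truncatedDown_mul_sumUpLeft_le (hY : IsForest Y) {ν : X → Y → ℝ}
    (hν : ∀ x y, 0 ≤ ν x y) {ε : ℝ} (hε : 0 ≤ ε) (A : X) (B : Y) :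
    ∑ y with y ≤ B, truncatedDown ν ε A y * sumUpLeft (truncatedDown ν ε) A y ≤
      ε * truncatedDown ν ε A B := by
  have h := hY.sum_truncated_mul_le (μ := fun y => ∑ x with x ≤ A, ν x y)
    (h := fun y => sumUpLeft (truncatedDown ν ε) A y)
    (p := fun y => sumUp (sumDown ν) A y ≤ ε) hε (fun y => sum_nonneg fun _ _ => hν _ _)
    (fun y => sumUpLeft_nonneg (truncatedDown_nonneg hν ε) A y)
    (fun _ _ hyb hy => (sumUp_anti (sumDown_nonneg hν) le_rfl hyb).trans hy)
    (fun _ hy => (sumUp_eq_sum_sumUpLeft _ _ _).symm.trans_le (sumUp_truncatedDown_le hν hy)) B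
  have hdown : ∀ b, ∑ y with y ≤ b, ∑ x with x ≤ A, ν x y = sumDown ν A b := fun b => sum_comm
  simp only [hdown] at h
  exact h

theorem sum_truncatedDown_mul_sumUpRight_le (hX : IsForest X) {ν : X → Y → ℝ}
    (hν : ∀ x y, 0 ≤ ν x y) {ε : ℝ} (hε : 0 ≤ ε) (A : X) (B : Y) :
    ∑ x with x ≤ A, truncatedDown ν ε x B * sumUpRight (truncatedDown ν ε) x B ≤
      ε * truncatedDown ν ε A B :=
  hX.sum_truncated_mul_le (μ := fun x => ∑ y with y ≤ B, ν x y)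
    (h := fun x => sumUpRight (truncatedDown ν ε) x B)
    (p := fun x => sumUp (sumDown ν) x B ≤ ε) hε (fun _ => sum_nonneg fun _ _ => hν _ _)
    (fun x => sumUpRight_nonneg (truncatedDown_nonneg hν ε) x B)
    (fun _ _ hxa hx => (sumUp_anti (sumDown_nonneg hν) hxa le_rfl).trans hx)
    (fun _ hx => (sumUp_eq_sum_sumUpRight _ _ _).symm.trans_le (sumUp_truncatedDown_le hν hx)) A

theorem sumUp_const_mul (c : ℝ) (F : X → Y → ℝ) (a : X) (b : Y) :
    sumUp (fun a b => c * F a b) a b = c * sumUp F a b := by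
  simp only [sumUp, mul_sum]

theorem sum_truncatedDown_mul_sumDown (ν : X → Y → ℝ) (ε : ℝ) :
    ∑ a, ∑ b, sumDown ν a b * truncatedDown ν ε a b = ∑ a, ∑ b, truncatedDown ν ε a b ^ 2 := by
  refine sum_congr rfl fun a _ => sum_congr rfl fun b _ => ?_
  unfold truncatedDown
  split_ifs <;> ring

/-- Exponential integrability of the truncated potential. -/
theorem sum_mul_exp_sub_one_le (hX : IsForest X) (hY : IsForest Y) {ν : X → Y → ℝ}
    (hν : ∀ x y, 0 ≤ ν x y) {ε : ℝ} (hε : 0 < ε) :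
    ∑ x, ∑ y, ν x y * (Real.exp (sumUp (truncatedDown ν ε) x y / (16 * ε)) - 1) ≤
      1 / (4 * ε) * (√(∑ a, ∑ b, truncatedDown ν ε a b ^ 2) * √(∑ a, ∑ b, sumDown ν a b ^ 2)) := by
  set c := 1 / (8 * ε) with hc
  have hc0 : 0 < c := by positivity
  have hcε : c * ε = 1 / 8 := by rw [hc]; field_simp
  set f := sumDown ν with hf
  set F := truncatedDown ν ε with hF
  have hF0 : ∀ a b, 0 ≤ F a b := truncatedDown_nonneg hν ε
  have hFf : ∀ a b, F a b ≤ f a b := truncatedDown_le hν ε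
  set S := ∑ a, ∑ b, F a b ^ 2 with hS
  set F' : X → Y → ℝ := fun a b => c * F a b with hF'
  have hF'0 : ∀ a b, 0 ≤ F' a b := fun a b => mul_nonneg hc0.le (hF0 a b)
  have hu : ∀ a b, F' a b ≠ 0 → sumUp F' a b ≤ 1 / 8 := by
    intro a b h
    rw [hF', sumUp_const_mul, ← hcε]
    refine mul_le_mul_of_nonneg_left (sumUp_truncatedDown_le hν ?_) hc0.le
    by_contra hn
    exact h (by simp [hF', hF, truncatedDown, hn])
  have hT := sum_exp_mul_sq_le hX hY hF'0 hu
    (fun A B => by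
      have h := mul_le_mul_of_nonneg_left
        (sum_truncatedDown_mul_sumUpLeft_le hY hν hε.le A B) (mul_nonneg hc0.le hc0.le)
      rw [mul_sum] at h
      simp only [hF', sumUpLeft_const_mul]
      rw [← hcε]
      refine (sum_congr rfl fun y _ => ?_).trans_le (h.trans_eq ?_) <;> ring)
    (fun A B => by
      have h := mul_le_mul_of_nonneg_left
        (sum_truncatedDown_mul_sumUpRight_le hX hν hε.le A B) (mul_nonneg hc0.le hc0.le)
      rw [mul_sum] at h
      simp only [hF', sumUpRight_const_mul]
      rw [← hcε]
      refine (sum_congr rfl fun y _ => ?_).trans_le (h.trans_eq ?_) <;> ring)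
  have hS' : ∑ a, ∑ b, F' a b ^ 2 = c ^ 2 * S := by
    simp only [hF', hS, mul_pow, mul_sum]
  have hexp : ∀ x y, Real.exp (sumUp F x y / (16 * ε)) - 1 ≤ sumUp (expKernel (1 / 2) F') x y := by
    intro x y
    have h := exp_sum_sum_le (by norm_num : (0 : ℝ) ≤ 1 / 2) hF'0
      (hX.isChain_filter x) (hY.isChain_filter y)
    have h2 : sumUp F x y / (16 * ε) = 1 / 2 * sumUp F' x y := by
      rw [hF', sumUp_const_mul, hc]; field_simp; ring
    rw [h2]
    exact sub_le_iff_le_add'.2 h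
  have h1 : ∑ x, ∑ y, ν x y * (Real.exp (sumUp F x y / (16 * ε)) - 1) ≤
      ∑ a, ∑ b, f a b * expKernel (1 / 2) F' a b := by
    rw [hf, ← sum_mul_sumUp]
    exact sum_le_sum fun x _ => sum_le_sum fun y _ =>
      mul_le_mul_of_nonneg_left (hexp x y) (hν x y)
  set w : X → Y → ℝ := fun a b =>
    sumUpLeft F' a b * sumUpRight F' a b * Real.exp (1 / 2 * sumUp F' a b) with hw
  have h2 : ∀ a b, f a b * expKernel (1 / 2) F' a b ≤
      c * (f a b * F a b) + 1 / 4 * (w a b * f a b) := by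
    intro a b
    have hf0 : 0 ≤ f a b := sumDown_nonneg hν a b
    have h3 : F' a b * Real.exp (1 / 2 * sumUp F' a b) ≤ F' a b * 2 := by
      by_cases h0 : F' a b = 0
      · simp [h0]
      · refine mul_le_mul_of_nonneg_left ?_ (hF'0 a b)
        have h5 := hu a b h0
        have h6 : 1 / 2 * sumUp F' a b ≤ Real.log 2 := by
          have := Real.log_two_gt_d9
          linarith
        calc _ ≤ Real.exp (Real.log 2) := Real.exp_le_exp.2 h6
          _ = 2 := Real.exp_log two_pos
    have h4 := mul_le_mul_of_nonneg_left h3 hf0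
    simp only [expKernel, hw]
    have h7 : F' a b = c * F a b := rfl
    rw [h7] at h4 ⊢
    nlinarith
  have hw2 : ∑ a, ∑ b, w a b ^ 2 ≤ c ^ 2 * S := by
    rw [← hS']
    refine le_trans (le_of_eq ?_) hT
    refine sum_congr rfl fun a _ => sum_congr rfl fun b _ => ?_
    rw [hw, mul_pow _ (Real.exp _), ← Real.exp_nat_mul]
    congr 2
    push_cast
    ring
  have h3 : ∑ a, ∑ b, w a b * f a b ≤ c * √S * √(∑ a, ∑ b, f a b ^ 2) := by
    refine (sum_sum_mul_le_sqrt w f).trans ?_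
    refine mul_le_mul_of_nonneg_right ?_ (Real.sqrt_nonneg _)
    refine (Real.sqrt_le_sqrt hw2).trans ?_
    rw [Real.sqrt_mul (sq_nonneg c), Real.sqrt_sq hc0.le]
  have h4 : ∑ a, ∑ b, f a b * F a b = S := sum_truncatedDown_mul_sumDown ν ε
  have hS0 : 0 ≤ S := sum_nonneg fun _ _ => sum_nonneg fun _ _ => sq_nonneg _
  have h5 : S ≤ √S * √(∑ a, ∑ b, f a b ^ 2) := by
    have h6 : √S ≤ √(∑ a, ∑ b, f a b ^ 2) :=
      Real.sqrt_le_sqrt (sum_le_sum fun a _ => sum_le_sum fun b _ =>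
        pow_le_pow_left₀ (hF0 a b) (hFf a b) 2)
    have h7 := Real.mul_self_sqrt hS0
    nlinarith [Real.sqrt_nonneg S]
  have h6 := h1.trans (sum_le_sum fun a _ => sum_le_sum fun b _ => h2 a b)
  simp only [sum_add_distrib, ← mul_sum] at h6
  rw [h4] at h6
  have h7 : 1 / (4 * ε) = 2 * c := by rw [hc]; field_simp; norm_num
  rw [h7]
  have h8 := mul_le_mul_of_nonneg_left h5 hc0.le
  have h9 : 0 ≤ √S * √(∑ a, ∑ b, f a b ^ 2) := by positivity
  nlinarith

theorem mass_mul_exp_sub_one_le (hX : IsForest X) (hY : IsForest Y) {ν : X → Y → ℝ}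
    (hν : ∀ x y, 0 ≤ ν x y) {ε : ℝ} (hε : 0 < ε) {t : ℝ}
    (ht : t * ∑ x, ∑ y, ν x y = (∑ a, ∑ b, truncatedDown ν ε a b ^ 2) / (16 * ε)) :
    (∑ x, ∑ y, ν x y) * (Real.exp t - 1) ≤
      1 / (4 * ε) * (√(∑ a, ∑ b, truncatedDown ν ε a b ^ 2) * √(∑ a, ∑ b, sumDown ν a b ^ 2)) := by
  refine le_trans ?_ (sum_mul_exp_sub_one_le hX hY hν hε)
  have hint : ∑ x, ∑ y, ν x y * (sumUp (truncatedDown ν ε) x y / (16 * ε)) =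
      t * ∑ x, ∑ y, ν x y := by
    rw [ht, ← sum_truncatedDown_mul_sumDown, ← sum_mul_sumUp]
    simp only [sum_div, mul_div_assoc]
  have hpt : ∀ x y, ν x y * ((Real.exp t - 1) +
      Real.exp t * (sumUp (truncatedDown ν ε) x y / (16 * ε) - t)) ≤
      ν x y * (Real.exp (sumUp (truncatedDown ν ε) x y / (16 * ε)) - 1) := by
    intro x y
    refine mul_le_mul_of_nonneg_left ?_ (hν x y)
    set z := sumUp (truncatedDown ν ε) x y / (16 * ε)
    have h := Real.add_one_le_exp (z - t)
    have h2 : Real.exp t * Real.exp (z - t) = Real.exp z := by rw [← Real.exp_add]; ring_nf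
    nlinarith [Real.exp_pos t]
  refine le_trans (le_of_eq ?_) (sum_le_sum fun x _ => sum_le_sum fun y _ => hpt x y)
  have hexpand : ∀ x y, ν x y * ((Real.exp t - 1) +
      Real.exp t * (sumUp (truncatedDown ν ε) x y / (16 * ε) - t)) =
      (Real.exp t - 1) * ν x y + (Real.exp t * (ν x y * (sumUp (truncatedDown ν ε) x y / (16 * ε)))
        - Real.exp t * t * ν x y) := fun x y => by ring
  simp only [hexpand, sum_add_distrib, sum_sub_distrib, ← mul_sum]
  rw [hint]
  ring

end PartialEnergy

theorem exists_rpow_le_mul_exp_sub_one {p : ℝ} (hp : 1 ≤ p) :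
    ∃ K : ℝ, 0 < K ∧ ∀ x : ℝ, 0 ≤ x → x ^ p ≤ K * (Real.exp x - 1) := by
  refine ⟨2 * (⌈p⌉₊).factorial, by positivity, fun x hx => ?_⟩
  have hfac : (1 : ℝ) ≤ (⌈p⌉₊).factorial := by
    exact_mod_cast Nat.succ_le_of_lt (Nat.factorial_pos _)
  have hexp := Real.add_one_le_exp x
  rcases le_total x 1 with h | h
  · have h1 : x ^ p ≤ x := by
      rcases hx.eq_or_lt with rfl | hx0
      · rw [Real.zero_rpow (by linarith)]
      · simpa using Real.rpow_le_rpow_of_exponent_ge hx0 h hp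
    nlinarith
  · have h1 : x ^ p ≤ x ^ ⌈p⌉₊ := by
      rw [← Real.rpow_natCast]
      exact Real.rpow_le_rpow_of_exponent_le h (Nat.le_ceil p)
    have h2 := Real.pow_div_factorial_le_exp x hx ⌈p⌉₊
    rw [div_le_iff₀ (by positivity)] at h2
    nlinarith

theorem exists_le_rpow_of_exp_sub_one_le {τ : ℝ} (h0 : 0 < τ) (h1 : τ < 1) :
    ∃ K : ℝ, 0 < K ∧ ∀ x y : ℝ, 0 ≤ x → 0 ≤ y → Real.exp x - 1 ≤ √x * √y → x ≤ K * y ^ τ := by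
  have hτ : 1 < 1 / τ := by rw [lt_div_iff₀ h0]; linarith
  obtain ⟨K, hK, h⟩ := exists_rpow_le_mul_exp_sub_one (p := 1 / 2 + 1 / (2 * τ)) (by
    have h : 1 / (2 * τ) = 1 / 2 * (1 / τ) := by ring
    linarith)
  refine ⟨K ^ (2 * τ), by positivity, fun x y hx hy hxy => ?_⟩
  rcases hx.eq_or_lt with rfl | hx0
  · positivity
  have h2 : x ^ (1 / (2 * τ)) ≤ K * √y := by
    have h3 := (h x hx).trans (mul_le_mul_of_nonneg_left hxy hK.le)
    rw [Real.rpow_add hx0, ← Real.sqrt_eq_rpow] at h3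
    have h4 := Real.sqrt_pos.2 hx0
    nlinarith
  have h3 := Real.rpow_le_rpow (by positivity) h2 (by positivity : 0 ≤ 2 * τ)
  rwa [← Real.rpow_mul hx, one_div_mul_cancel (by positivity), Real.rpow_one,
    Real.mul_rpow hK.le (Real.sqrt_nonneg y), Real.sqrt_eq_rpow, ← Real.rpow_mul hy,
    ← mul_assoc, one_div_mul_cancel two_ne_zero, one_mul] at h3

section BiTree

theorem eq_zero_of_sum_sum_eq_zero {X Y : Type*} [Fintype X] [Fintype Y] {ν : X → Y → ℝ}
    (hν : ∀ x y, 0 ≤ ν x y) (h : ∑ x, ∑ y, ν x y = 0) (x : X) (y : Y) : ν x y = 0 := by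
  rw [sum_eq_zero_iff_of_nonneg fun x _ => sum_nonneg fun y _ => hν x y] at h
  exact (sum_eq_zero_iff_of_nonneg fun y _ => hν x y).1 (h x (mem_univ x)) y (mem_univ y)

/-- The surrogate maximum principle for a product of two finite forests. -/
theorem exists_sum_truncatedDown_sq_le {τ : ℝ} (h0 : 0 < τ) (h1 : τ < 1) :
    ∃ C : ℝ, 0 < C ∧ ∀ {X Y : Type} [Fintype X] [PartialOrder X] [DecidableLE X]
      [Fintype Y] [PartialOrder Y] [DecidableLE Y], IsForest X → IsForest Y →
      ∀ ν : X → Y → ℝ, (∀ x y, 0 ≤ ν x y) → ∀ ε : ℝ, 0 < ε →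
      ∑ a, ∑ b, truncatedDown ν ε a b ^ 2 ≤
        C * ε ^ (1 - τ) * (∑ a, ∑ b, sumDown ν a b ^ 2) ^ τ * (∑ x, ∑ y, ν x y) ^ (1 - τ) := by
  obtain ⟨K, hK, h⟩ := exists_le_rpow_of_exp_sub_one_le h0 h1
  refine ⟨16 * K, by positivity, ?_⟩
  intro X Y _ _ _ _ _ _ hX hY ν hν ε hε
  have hexp := fun t => mass_mul_exp_sub_one_le hX hY hν hε (t := t)
  have hM0 : 0 ≤ ∑ x, ∑ y, ν x y := sum_nonneg fun _ _ => sum_nonneg fun _ _ => hν _ _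
  rcases hM0.eq_or_lt with hM | hM
  · have hz := eq_zero_of_sum_sum_eq_zero hν hM.symm
    have hS : ∑ a, ∑ b, truncatedDown ν ε a b ^ 2 = 0 := by
      simp [truncatedDown, sumDown, hz]
    rw [hS]
    positivity
  · set S := ∑ a, ∑ b, truncatedDown ν ε a b ^ 2 with hS
    set E := ∑ a, ∑ b, sumDown ν a b ^ 2 with hE
    set M := ∑ x, ∑ y, ν x y
    have hS0 : 0 ≤ S := sum_nonneg fun _ _ => sum_nonneg fun _ _ => sq_nonneg _
    have hE0 : 0 ≤ E := sum_nonneg fun _ _ => sum_nonneg fun _ _ => sq_nonneg _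
    have hεM : 0 < ε * M := mul_pos hε hM
    have hsqrt : √S * √E = 4 * (ε * M) * (√(S / (16 * (ε * M))) * √(E / (ε * M))) := by
      rw [Real.sqrt_div hS0, Real.sqrt_div hE0, Real.sqrt_mul (by norm_num),
        show (16 : ℝ) = 4 ^ 2 by norm_num, Real.sqrt_sq (by norm_num)]
      have h3 := Real.sqrt_pos.2 hεM
      field_simp
      rw [Real.sq_sqrt hεM.le]
      ring
    have h2 := hexp (S / (16 * (ε * M))) (by field_simp)
    have h3 := h (S / (16 * (ε * M))) (E / (ε * M)) (by positivity) (by positivity) (by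
      rw [hsqrt] at h2
      refine le_of_mul_le_mul_left (h2.trans_eq ?_) hM
      field_simp)
    rw [div_le_iff₀ (by positivity), Real.div_rpow hE0 hεM.le] at h3
    refine h3.trans_eq ?_
    have h4 : (ε * M) ^ τ * (ε ^ (1 - τ) * M ^ (1 - τ)) = ε * M := by
      rw [← Real.mul_rpow hε.le hM.le, ← Real.rpow_add hεM]
      simp
    have h5 : 0 < (ε * M) ^ τ := Real.rpow_pos_of_pos hεM τ
    generalize (ε * M) ^ τ = d at *
    rw [← h4]
    field_simp

/-- The vertices of the dyadic tree of depth `N`, with ancestors above their descendants. -/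
structure DyadicTree (N : ℕ) where
  /-- The binary string of a vertex. -/
  word : List Bool
  mem : word ∈ strings N

namespace DyadicTree

variable {N : ℕ}

/-- The vertices of the tree as a subtype of the binary strings. -/
def equivSubtype : {a : List Bool // a ∈ strings N} ≃ DyadicTree N where
  toFun a := ⟨a.1, a.2⟩
  invFun a := ⟨a.word, a.mem⟩

instance : Fintype (DyadicTree N) := Fintype.ofEquiv _ equivSubtype

instance : PartialOrder (DyadicTree N) where
  le a b := b.word <+: a.word
  le_refl a := List.prefix_rfl
  le_trans _ _ _ hab hbc := hbc.trans hab
  le_antisymm a b hab hba := by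
    cases a
    cases b
    congr
    exact hba.eq_of_length (hba.length_le.antisymm hab.length_le)

instance : DecidableLE (DyadicTree N) := fun a b => inferInstanceAs (Decidable (b.word <+: a.word))

theorem isForest : IsForest (DyadicTree N) :=
  fun _ a b ha hb => (le_total b.word.length a.word.length).imp
    (List.prefix_of_prefix_length_le hb ha) (List.prefix_of_prefix_length_le ha hb)

theorem sum_strings (f : List Bool → ℝ) : ∑ a ∈ strings N, f a = ∑ a : DyadicTree N, f a.word := by
  rw [← sum_coe_sort]
  exact Fintype.sum_equiv equivSubtype _ _ fun _ => rfl

theorem sum_biVertices (f : List Bool × List Bool → ℝ) :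
    ∑ p ∈ biVertices N, f p = ∑ a : DyadicTree N, ∑ b : DyadicTree N, f (a.word, b.word) := by
  rw [biVertices, sum_product, sum_strings]
  exact sum_congr rfl fun a _ => sum_strings _

variable {ν : List Bool × List Bool → ℝ}

theorem biIstar_eq (a b : DyadicTree N) :
    biIstar N ν (a.word, b.word) =
      sumDown (fun x y : DyadicTree N => ν (x.word, y.word)) a b := by
  simp only [biIstar, sumDown, sum_filter, sum_biVertices, ite_and]
  refine sum_congr rfl fun x _ => ?_
  change (∑ y : DyadicTree N, if x ≤ a then if y ≤ b then _ else _ else _) = _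
  split_ifs <;> simp

theorem biV_eq (a b : DyadicTree N) :
    biV N ν (a.word, b.word) =
      sumUp (sumDown fun x y : DyadicTree N => ν (x.word, y.word)) a b := by
  simp only [biV, biI, sumUp, sum_filter, sum_biVertices, ite_and, biIstar_eq]
  refine sum_congr rfl fun x _ => ?_
  change (∑ y : DyadicTree N, if a ≤ x then if b ≤ y then _ else _ else _) = _
  split_ifs <;> simp

theorem biEnergy_eq :
    biEnergy N ν = ∑ a : DyadicTree N, ∑ b : DyadicTree N,
      sumDown (fun x y : DyadicTree N => ν (x.word, y.word)) a b ^ 2 := by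
  simp only [biEnergy, sum_biVertices, biIstar_eq]

theorem biPartialEnergy_eq (ε : ℝ) :
    biPartialEnergy N ν ε = ∑ a : DyadicTree N, ∑ b : DyadicTree N,
      truncatedDown (fun x y : DyadicTree N => ν (x.word, y.word)) ε a b ^ 2 := by
  simp only [biPartialEnergy, sum_filter, sum_biVertices, biIstar_eq, biV_eq, truncatedDown,
    ite_pow, zero_pow two_ne_zero]

end DyadicTree

end BiTree

/-- **Improved surrogate maximum principle**: `E_ε[ν] ≤ C_τ ε^{1−τ} E[ν]^τ |ν|^{1−τ}`
for every `τ ∈ (0,1)`. (Real exponents are `Real.rpow`.) -/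
theorem stmt9 : ∀ τ : ℝ, 0 < τ → τ < 1 → ∃ C : ℝ, 0 < C ∧ ∀ N : ℕ, 1 ≤ N →
    ∀ ν : List Bool × List Bool → ℝ, IsBiMeasureOnBoundary N ν →
    ∀ ε : ℝ, 0 < ε →
    biPartialEnergy N ν ε ≤
      C * ε ^ (1 - τ) * (biEnergy N ν) ^ τ * (biMass N ν) ^ (1 - τ) := by
  intro τ h0 h1
  obtain ⟨C, hC, h⟩ := exists_sum_truncatedDown_sq_le h0 h1
  refine ⟨C, hC, fun N _ ν hν ε hε => ?_⟩
  rw [DyadicTree.biPartialEnergy_eq, DyadicTree.biEnergy_eq, biMass, DyadicTree.sum_biVertices]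
  exact h DyadicTree.isForest DyadicTree.isForest _ (fun x y => hν.1 _) ε hε
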